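/- The asymptotic densities of 𝔑_{47058} and 𝔑_{2214502422} exist and satisfy 0.0560465 < δ(𝔑_{47058}) < 0.0800567 and 0.0070565 < δ(𝔑_{2214502422}) < 0.0800567. -/

import Mathlib

/-- The power sum `S m k = 1^m + 2^m + ⋯ + k^m`. -/
def S (m k : ℕ) : ℕ := ∑ i ∈ Finset.Icc 1 k, i ^ m

/-- The set `𝔑_Q` of positive integers `n` with `S_{Qn}(Qn) ≡ n (mod Qn)`. -/
def Nset (Q : ℕ) : Set ℕ := {n | 0 < n ∧ S (Q * n) (Q * n) ≡ n [MOD Q * n]}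

/-- A set `A` of positive integers has asymptotic density `δ` if
`card (A ∩ [1, N]) / N → δ` as `N → ∞`. -/
def HasDensity (A : Set ℕ) (δ : ℝ) : Prop :=
  Filter.Tendsto (fun N : ℕ => ((A ∩ Set.Icc 1 N).ncard : ℝ) / N)
    Filter.atTop (nhds δ)

lemma sum_range_mul_natCast_zmod {M : Type*} [AddCommMonoid M] (N r : ℕ) [NeZero N]
    (f : ZMod N → M) :
    ∑ i ∈ Finset.range (N * r), f (i : ZMod N) = r • ∑ x : ZMod N, f x := by
  have h1 : ∑ i ∈ Finset.range N, f (i : ZMod N) = ∑ x : ZMod N, f x := by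
    refine Finset.sum_bij (fun i _ => (i : ZMod N)) (fun _ _ => Finset.mem_univ _) ?_ ?_
      (fun _ _ => rfl)
    · intro a ha b hb hab
      rw [ZMod.natCast_eq_natCast_iff'] at hab
      rwa [Nat.mod_eq_of_lt (Finset.mem_range.1 ha), Nat.mod_eq_of_lt (Finset.mem_range.1 hb)]
        at hab
    · intro x _
      exact ⟨x.val, Finset.mem_range.2 (ZMod.val_lt x), ZMod.natCast_zmod_val x⟩
  induction r with
  | zero => simp
  | succ r ih =>
    rw [Nat.mul_succ, Finset.sum_range_add, ih, succ_nsmul, ← h1]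
    congr 1
    refine Finset.sum_congr rfl fun i _ => ?_
    simp

lemma sum_pow_zmod_of_not_dvd {p a m : ℕ} (hp : p.Prime) (h : ¬ p - 1 ∣ m) [NeZero (p ^ a)] :
    ∑ x : ZMod (p ^ a), x ^ m = 0 := by
  have := Fact.mk hp
  obtain ⟨g, hg⟩ := IsCyclic.exists_generator (α := (ZMod p)ˣ)
  have hord := orderOf_eq_card_of_forall_mem_zpowers hg
  rw [Nat.card_eq_fintype_card, ZMod.card_units_eq_totient, Nat.totient_prime hp] at hord
  have hgm : g ^ m ≠ 1 := fun hh => h (hord ▸ orderOf_dvd_of_pow_eq_one hh)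
  set n : ℕ := (g : ZMod p).val with hn
  have hng : ((n : ℕ) : ZMod p) = g := ZMod.natCast_zmod_val _
  have hnp : ¬ p ∣ n := by
    intro hd
    rw [(ZMod.natCast_eq_zero_iff n p).2 hd] at hng
    exact g.ne_zero hng.symm
  have hu : IsUnit ((n : ℕ) : ZMod (p ^ a)) :=
    (ZMod.isUnit_iff_coprime _ _).2 (((hp.coprime_iff_not_dvd.2 hnp).symm).pow_right a)
  have hv : IsUnit (((n : ℤ) ^ m - 1 : ℤ) : ZMod (p ^ a)) := by
    rw [ZMod.coe_int_isUnit_iff_isCoprime]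
    push_cast
    apply IsCoprime.pow_left
    rw [(Nat.prime_iff_prime_int.1 hp).irreducible.coprime_iff_not_dvd]
    intro hd
    rw [← ZMod.intCast_zmod_eq_zero_iff_dvd] at hd
    push_cast at hd
    rw [hng, sub_eq_zero] at hd
    exact hgm (Units.ext (by simpa using hd))
  obtain ⟨u, hu⟩ := hu
  have hs : ∑ x : ZMod (p ^ a), x ^ m = ∑ x : ZMod (p ^ a), ((u : ZMod (p ^ a)) * x) ^ m :=
    (Fintype.sum_equiv (Units.mulLeft u) _ _ (fun x => by simp)).symm
  simp_rw [mul_pow] at hs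
  rw [← Finset.mul_sum, hu] at hs
  push_cast at hv
  have : ((n : ZMod (p ^ a)) ^ m - 1) * ∑ x : ZMod (p ^ a), x ^ m = 0 := by
    rw [sub_mul, ← hs, one_mul, sub_self]
  exact (hv.mul_right_eq_zero).1 this

lemma sum_pow_zmod_of_dvd {p a m : ℕ} (hp : p.Prime) (ha : 0 < a) (hm : 0 < m)
    (hpm : p ^ a ∣ m) (h : p - 1 ∣ m) [NeZero (p ^ a)] :
    ∑ x : ZMod (p ^ a), x ^ m = ((p ^ a).totient : ℕ) := by
  classical
  have hφ : (p ^ a).totient ∣ m := by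
    rw [Nat.totient_prime_pow hp ha]
    refine Nat.Coprime.mul_dvd_of_dvd_of_dvd ?_ ((pow_dvd_pow p (by omega)).trans hpm) h
    apply Nat.Coprime.pow_left
    rw [hp.coprime_iff_not_dvd]
    intro hd
    have := Nat.le_of_dvd (by have := hp.two_le; omega) hd
    have := hp.two_le
    omega
  have ham : a ≤ m := (Nat.lt_pow_self hp.one_lt).le.trans (Nat.le_of_dvd hm hpm)
  have key : ∀ x : ZMod (p ^ a), x ^ m = if IsUnit x then 1 else 0 := by
    intro x
    split_ifs with hx
    · obtain ⟨u, rfl⟩ := hx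
      obtain ⟨c, hc⟩ := hφ
      rw [hc, pow_mul, ← Units.val_pow_eq_pow_val, ZMod.pow_totient, Units.val_one, one_pow]
    · rw [← ZMod.natCast_zmod_val x, ZMod.isUnit_iff_coprime] at hx
      rw [← ZMod.natCast_zmod_val x]
      have hd : p ∣ x.val := by
        by_contra hnd
        exact hx (((hp.coprime_iff_not_dvd.2 hnd).symm).pow_right a)
      rw [← Nat.cast_pow, ZMod.natCast_eq_zero_iff]
      exact (pow_dvd_pow p ham).trans (pow_dvd_pow_of_dvd hd m)
  simp_rw [key]
  rw [Finset.sum_boole, ← ZMod.card_units_eq_totient, ← Fintype.card_subtype]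
  congr 1
  exact Fintype.card_congr (Equiv.symm
    ⟨fun u => ⟨u, u.isUnit⟩, fun x => x.2.unit, fun u => Units.ext rfl, fun x => Subtype.ext rfl⟩)

lemma S_self_zmod {p a r m : ℕ} (hp : p.Prime) (ha : 0 < a) (hm : 0 < m) (hmr : m = p ^ a * r) :
    (S m m : ZMod (p ^ a)) = if p - 1 ∣ m then (r : ZMod (p ^ a)) * ((p ^ a).totient : ℕ) else 0 := by
  have : NeZero (p ^ a) := ⟨(pow_pos hp.pos a).ne'⟩
  have hm0 : (m : ZMod (p ^ a)) = 0 := (ZMod.natCast_eq_zero_iff _ _).2 ⟨r, hmr⟩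
  have h1 : (S m m : ZMod (p ^ a)) = ∑ i ∈ Finset.range m, (i : ZMod (p ^ a)) ^ m := by
    have h2 := Finset.sum_range_succ (fun i : ℕ => (i : ZMod (p ^ a)) ^ m) m
    rw [hm0, zero_pow hm.ne', add_zero] at h2
    rw [← h2, Finset.range_eq_Ico, Finset.sum_eq_sum_Ico_succ_bot (by omega), S]
    push_cast
    rw [zero_pow hm.ne', zero_add]
    rfl
  have h2 := sum_range_mul_natCast_zmod (p ^ a) r (fun x => x ^ m)
  rw [← hmr] at h2
  rw [h1, h2, nsmul_eq_mul]
  split_ifs with h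
  · rw [sum_pow_zmod_of_dvd hp ha hm ⟨r, hmr⟩ h]
  · rw [sum_pow_zmod_of_not_dvd hp h, mul_zero]

lemma S_self_modEq_prime_pow_iff {Q n p a r : ℕ} (hQ : ∀ p q : ℕ, p.Prime → Q = p * q → p ∣ q + 1)
    (hm : 0 < Q * n) (hp : p.Prime) (ha : 0 < a) (hmr : Q * n = p ^ a * r) (hr : ¬ p ∣ r) :
    S (Q * n) (Q * n) ≡ n [MOD p ^ a] ↔ (p ∣ Q ↔ p - 1 ∣ Q * n) := by
  rw [← ZMod.natCast_eq_natCast_iff, S_self_zmod hp ha hm hmr]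
  obtain ⟨b, rfl⟩ : ∃ b, a = b + 1 := ⟨a - 1, by omega⟩
  have hp2 := hp.two_le
  split_ifs with h
  · rw [iff_true_right h, Nat.totient_prime_pow hp ha, ← Nat.cast_mul,
      ZMod.natCast_eq_natCast_iff, Nat.add_sub_cancel]
    constructor
    · intro hmod
      by_contra hpQ
      have hn : p ^ (b + 1) ∣ n :=
        (((hp.coprime_iff_not_dvd.2 hpQ).pow_left (b + 1))).dvd_of_dvd_mul_left ⟨r, hmr⟩
      have h0 := (hmod.trans ((Nat.modEq_zero_iff_dvd).2 hn))
      rw [Nat.modEq_zero_iff_dvd, pow_succ, mul_left_comm,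
        Nat.mul_dvd_mul_iff_left (pow_pos hp.pos b), hp.dvd_mul] at h0
      rcases h0 with h0 | h0
      · exact hr h0
      · have := Nat.le_of_dvd (by omega) h0
        omega
    · rintro ⟨q, rfl⟩
      have hq := hQ p q hp rfl
      have hpq : ¬ p ∣ q := fun hd => by
        have := (Nat.dvd_add_right hd).1 hq
        exact hp.one_lt.ne' (Nat.dvd_one.1 this)
      have h1 : q * n = p ^ b * r := by
        apply Nat.eq_of_mul_eq_mul_left hp.pos
        rw [← mul_assoc, hmr, pow_succ]; ring
      obtain ⟨n', rfl⟩ : p ^ b ∣ n :=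
        ((hp.coprime_iff_not_dvd.2 hpq).pow_left b).dvd_of_dvd_mul_left ⟨r, h1⟩
      have h2 : r = q * n' := by
        apply Nat.eq_of_mul_eq_mul_left (pow_pos hp.pos b)
        rw [← h1]; ring
      subst h2
      obtain ⟨t, ht⟩ := hq
      rw [Nat.modEq_iff_dvd]
      push_cast [hp.one_le]
      refine ⟨n' * (t - q), ?_⟩
      have ht' : (q : ℤ) + 1 = p * t := by exact_mod_cast ht
      linear_combination (p : ℤ) ^ b * n' * ht'
  · rw [iff_false_right h, ← Nat.cast_zero, ZMod.natCast_eq_natCast_iff]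
    constructor
    · rintro hmod ⟨q, rfl⟩
      obtain ⟨c, hc⟩ := Nat.modEq_zero_iff_dvd.1 hmod.symm
      apply hr
      refine ⟨q * c, ?_⟩
      apply Nat.eq_of_mul_eq_mul_left (pow_pos hp.pos (b + 1))
      rw [← hmr, hc]; ring
    · intro hpQ
      exact (Nat.modEq_zero_iff_dvd.2
        (((hp.coprime_iff_not_dvd.2 hpQ).pow_left (b + 1)).dvd_of_dvd_mul_left ⟨r, hmr⟩)).symm

/-- Membership in `𝔑_Q` is decided one prime at a time. -/
lemma mem_Nset_iff {Q n : ℕ} (hQ0 : 0 < Q) (hQ : ∀ p q : ℕ, p.Prime → Q = p * q → p ∣ q + 1) :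
    n ∈ Nset Q ↔ 0 < n ∧ ∀ p : ℕ, p.Prime → p ∣ Q * n → (p ∣ Q ↔ p - 1 ∣ Q * n) := by
  refine and_congr_right fun hn => ?_
  have hm : 0 < Q * n := Nat.mul_pos hQ0 hn
  have hdec : ∀ p : ℕ, p.Prime → p ∣ Q * n →
      ∃ a r, 0 < a ∧ Q * n = p ^ a * r ∧ ¬ p ∣ r := by
    intro p hp hpd
    obtain ⟨a, r, hr, har⟩ := Nat.exists_eq_pow_mul_and_not_dvd hm.ne' p hp.ne_one
    refine ⟨a, r, Nat.pos_of_ne_zero ?_, har, hr⟩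
    rintro rfl
    rw [pow_zero, one_mul] at har
    exact hr (har ▸ hpd)
  constructor
  · intro hmod p hp hpd
    obtain ⟨a, r, ha, har, hr⟩ := hdec p hp hpd
    exact (S_self_modEq_prime_pow_iff hQ hm hp ha har hr).1 (hmod.of_dvd ⟨r, har⟩)
  · intro hloc
    rw [Nat.modEq_iff_dvd, Int.natCast_dvd, Nat.dvd_iff_prime_pow_dvd_dvd]
    intro p k hp hk
    rcases Nat.eq_zero_or_pos k with rfl | hk0
    · simp
    have hpd : p ∣ Q * n := (dvd_pow_self p hk0.ne').trans hk
    obtain ⟨a, r, ha, har, hr⟩ := hdec p hp hpd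
    have hka : k ≤ a := by
      by_contra! hlt
      apply hr
      have h1 : p ^ (a + 1) ∣ p ^ a * r := har ▸ (pow_dvd_pow p hlt).trans hk
      rwa [pow_succ, Nat.mul_dvd_mul_iff_left (pow_pos hp.pos a)] at h1
    have hmod := (S_self_modEq_prime_pow_iff hQ hm hp ha har hr).2 (hloc p hp hpd)
    rw [Nat.modEq_iff_dvd, Int.natCast_dvd] at hmod
    exact (pow_dvd_pow p hka).trans hmod

/-- The positive integers divisible by no `e i`. -/
def avoid (e : ℕ → ℕ) : Set ℕ := {k | 0 < k ∧ ∀ i, ¬ e i ∣ k}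

/-- For primes `p ∤ Q` the number whose multiples `k` have to be removed in order that
`5 * k ∈ 𝔑_Q`; the value `0` for all other `p` removes nothing. -/
def obstruction (Q p : ℕ) : ℕ :=
  if p.Prime ∧ ¬ p ∣ Q then
    if p = 5 then 2 else p * ((p - 1) / (p - 1).gcd (5 * Q))
  else 0

lemma dvd_mul_left_iff_div_gcd_dvd {a b c : ℕ} (ha : 0 < a) : a ∣ b * c ↔ a / a.gcd b ∣ c := by
  have hg : 0 < a.gcd b := Nat.gcd_pos_of_pos_left b ha
  have hc := Nat.coprime_div_gcd_div_gcd hg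
  conv_lhs => rw [← Nat.mul_div_cancel' (Nat.gcd_dvd_left a b)]
  conv_lhs => rhs; lhs; rw [← Nat.mul_div_cancel' (Nat.gcd_dvd_right a b)]
  rw [mul_assoc, Nat.mul_dvd_mul_iff_left hg]
  exact ⟨fun h => hc.dvd_of_dvd_mul_left h, fun h => h.mul_left _⟩

lemma Nset_eq_image_avoid {Q : ℕ} (hQ0 : 0 < Q)
    (hQ : ∀ p q : ℕ, p.Prime → Q = p * q → p ∣ q + 1)
    (h31 : 31 ∣ Q) (h5 : ¬ 5 ∣ Q) (h4 : Q % 4 = 2)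
    (hpred : ∀ p : ℕ, p.Prime → p ∣ Q → p - 1 ∣ 5 * Q) :
    Nset Q = {n | ∃ k ∈ avoid (obstruction Q), n = 5 * k} := by
  have hobs : ∀ k p : ℕ, 0 < k → p.Prime → ¬ p ∣ Q →
      (obstruction Q p ∣ k ↔ p ∣ 5 * k ∧ p - 1 ∣ 5 * Q * k) := by
    intro k p hk hp hpQ
    have hp2 := hp.two_le
    rw [obstruction, if_pos ⟨hp, hpQ⟩]
    split_ifs with hp5
    · subst hp5
      rw [and_iff_right (Dvd.intro k rfl), dvd_mul_left_iff_div_gcd_dvd (by norm_num)]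
      have : Nat.gcd (5 - 1) (5 * Q) = 2 := by
        have h1 : (5 * Q) % 4 = 2 := by omega
        rw [Nat.gcd_rec, h1]
        rfl
      rw [this]
    · have hc5 : Nat.Coprime p 5 := (Nat.coprime_primes hp (by norm_num)).2 hp5
      have hcp : Nat.Coprime p ((p - 1) / (p - 1).gcd (5 * Q)) := by
        apply Nat.Coprime.coprime_dvd_right (Nat.div_dvd_of_dvd (Nat.gcd_dvd_left _ _))
        rw [hp.coprime_iff_not_dvd]
        intro hd
        have := Nat.le_of_dvd (by omega) hd
        omega
      rw [hc5.dvd_mul_left, dvd_mul_left_iff_div_gcd_dvd (a := p - 1) (by omega)]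
      exact ⟨fun h => ⟨dvd_of_mul_right_dvd h, dvd_of_mul_left_dvd h⟩,
        fun h => hcp.mul_dvd_of_dvd_of_dvd h.1 h.2⟩
  ext n
  rw [mem_Nset_iff hQ0 hQ]
  constructor
  · rintro ⟨hn, h⟩
    have h30 := (h 31 (by norm_num) (h31.mul_right n)).1 h31
    obtain ⟨k, rfl⟩ : 5 ∣ n :=
      ((Nat.prime_five.dvd_mul).1 ((by norm_num : 5 ∣ 31 - 1).trans h30)).resolve_left h5
    have hk : 0 < k := by omega
    refine ⟨k, ⟨hk, fun p hd => ?_⟩, rfl⟩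
    by_cases hpc : p.Prime ∧ ¬ p ∣ Q
    · obtain ⟨hp, hpQ⟩ := hpc
      obtain ⟨h1, h2⟩ := (hobs k p hk hp hpQ).1 hd
      refine hpQ ((h p hp (h1.mul_left Q)).2 ?_)
      rwa [mul_left_comm, ← mul_assoc]
    · rw [obstruction, if_neg hpc, zero_dvd_iff] at hd
      omega
  · rintro ⟨k, ⟨hk, h⟩, rfl⟩
    refine ⟨by omega, fun p hp hd => ?_⟩
    have he : Q * (5 * k) = 5 * Q * k := by ring
    by_cases hpQ : p ∣ Q
    · rw [iff_true_left hpQ, he]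
      exact (hpred p hp hpQ).mul_right k
    · rw [iff_false_left hpQ, he]
      intro h2
      exact h p ((hobs k p hk hp hpQ).2 ⟨(hp.dvd_mul.1 hd).resolve_left hpQ, h2⟩)

/-- The positive integers divisible by no member of `L`. -/
def avoidList (L : List ℕ) : Set ℕ := {k | 0 < k ∧ ∀ e ∈ L, ¬ e ∣ k}

lemma finite_inter_Icc (A : Set ℕ) (N : ℕ) : (A ∩ Set.Icc 1 N).Finite :=
  (Set.finite_Icc 1 N).inter_of_right A

lemma HasDensity.le_of_forall_ncard_le {A : Set ℕ} {a b : ℝ} {f : ℕ → ℝ} (hA : HasDensity A a)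
    (hf : Filter.Tendsto (fun N : ℕ => f N / N) Filter.atTop (nhds b))
    (h : ∀ N : ℕ, ((A ∩ Set.Icc 1 N).ncard : ℝ) ≤ f N) : a ≤ b :=
  le_of_tendsto_of_tendsto' hA hf fun N => by gcongr; exact h N

lemma HasDensity.mono {A B : Set ℕ} {a b : ℝ} (hA : HasDensity A a) (hB : HasDensity B b)
    (h : A ⊆ B) : a ≤ b :=
  hA.le_of_forall_ncard_le hB fun N => by
    exact_mod_cast Set.ncard_le_ncard (Set.inter_subset_inter_left _ h) (finite_inter_Icc B N)

lemma HasDensity.nonneg {A : Set ℕ} {a : ℝ} (hA : HasDensity A a) : 0 ≤ a :=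
  ge_of_tendsto' hA fun N => by positivity

lemma HasDensity.le_add {A B C : Set ℕ} {a b c : ℝ} (hA : HasDensity A a) (hB : HasDensity B b)
    (hC : HasDensity C c) (h : A ⊆ B ∪ C) : a ≤ b + c := by
  refine hA.le_of_forall_ncard_le
    (f := fun N => ((B ∩ Set.Icc 1 N).ncard : ℝ) + (C ∩ Set.Icc 1 N).ncard) ?_ fun N => ?_
  · simp_rw [add_div]
    exact Filter.Tendsto.add hB hC
  · have h1 : A ∩ Set.Icc 1 N ⊆ B ∩ Set.Icc 1 N ∪ C ∩ Set.Icc 1 N := by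
      rw [← Set.union_inter_distrib_right]
      exact Set.inter_subset_inter_left _ h
    exact_mod_cast (Set.ncard_le_ncard h1 ((finite_inter_Icc B N).union
      (finite_inter_Icc C N))).trans (Set.ncard_union_le _ _)

lemma HasDensity.diff {A B : Set ℕ} {a b : ℝ} (hA : HasDensity A a) (hB : HasDensity B b)
    (h : B ⊆ A) : HasDensity (A \ B) (a - b) := by
  refine (Filter.Tendsto.sub hA hB).congr fun N => ?_
  rw [← sub_div]
  congr 1
  have h1 : (A \ B) ∩ Set.Icc 1 N = (A ∩ Set.Icc 1 N) \ (B ∩ Set.Icc 1 N) := by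
    ext x; simp only [Set.mem_inter_iff, Set.mem_sdiff]; tauto
  have h2 := Set.ncard_sdiff_add_ncard_of_subset
    (Set.inter_subset_inter_left (Set.Icc 1 N) h) (finite_inter_Icc A N)
  rw [h1, ← h2]
  push_cast
  ring

lemma ncard_multiples_inter_Icc (A : Set ℕ) {e : ℕ} (he : 0 < e) (N : ℕ) :
    ({n | ∃ k ∈ A, n = e * k} ∩ Set.Icc 1 N).ncard = (A ∩ Set.Icc 1 (N / e)).ncard := by
  rw [← Set.ncard_image_of_injective (A ∩ Set.Icc 1 (N / e))
    (fun _ _ h => Nat.eq_of_mul_eq_mul_left he h : Function.Injective (e * ·))]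
  congr 1
  ext n
  simp only [Set.mem_inter_iff, Set.mem_ofPred_eq, Set.mem_Icc, Set.mem_image]
  constructor
  · rintro ⟨⟨k, hk, rfl⟩, h1, h2⟩
    refine ⟨k, ⟨hk, Nat.pos_of_mul_pos_left h1, ?_⟩, rfl⟩
    rwa [Nat.le_div_iff_mul_le he, mul_comm]
  · rintro ⟨k, ⟨hk, h1, h2⟩, rfl⟩
    rw [Nat.le_div_iff_mul_le he, mul_comm] at h2
    exact ⟨⟨k, hk, rfl⟩, Nat.mul_pos he h1, h2⟩

lemma HasDensity.multiples {A : Set ℕ} {a : ℝ} (hA : HasDensity A a) {e : ℕ} (he : 0 < e) :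
    HasDensity {n | ∃ k ∈ A, n = e * k} (a / e) := by
  have h1 := (hA.comp (Nat.tendsto_div_const_atTop he.ne'))
  have h2 : Filter.Tendsto (fun N : ℕ => ((N / e : ℕ) : ℝ) / N) Filter.atTop
      (nhds (1 / e : ℝ)) := by
    have := (tendsto_nat_floor_mul_div_atTop (R := ℝ) (a := 1 / e) (by positivity)).comp
      (tendsto_natCast_atTop_atTop (R := ℝ))
    refine this.congr fun N => ?_
    simp only [Function.comp]
    rw [one_div_mul_eq_div, Nat.floor_div_eq_div]
  have h3 := h1.mul h2
  rw [mul_one_div] at h3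
  refine h3.congr fun N => ?_
  simp only [Function.comp]
  rw [ncard_multiples_inter_Icc A he]
  rcases Nat.eq_zero_or_pos (N / e) with h0 | h0
  · simp [h0]
  · have : ((N / e : ℕ) : ℝ) ≠ 0 := by exact_mod_cast h0.ne'
    field_simp

lemma hasDensity_avoidList_nil : HasDensity (avoidList []) 1 := by
  refine tendsto_const_nhds.congr' ?_
  filter_upwards [Filter.eventually_gt_atTop 0] with N hN
  have h : avoidList [] ∩ Set.Icc 1 N = (Finset.Icc 1 N : Set ℕ) := by
    ext k
    simp [avoidList]
    omega
  rw [h, Set.ncard_coe_finset, Nat.card_Icc, Nat.add_sub_cancel, div_self]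
  exact_mod_cast hN.ne'

lemma avoidList_cons (e : ℕ) (L : List ℕ) :
    avoidList (e :: L) =
      avoidList L \ {n | ∃ k ∈ avoidList (L.map fun x => x / x.gcd e), n = e * k} := by
  ext n
  simp only [avoidList, Set.mem_ofPred_eq, Set.mem_sdiff, List.forall_mem_cons, List.forall_mem_map]
  constructor
  · rintro ⟨h0, h1, h2⟩
    refine ⟨⟨h0, h2⟩, ?_⟩
    rintro ⟨k, -, rfl⟩
    exact h1 (dvd_mul_right e k)
  · rintro ⟨⟨h0, h2⟩, h3⟩
    refine ⟨h0, ?_, h2⟩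
    rintro ⟨k, rfl⟩
    refine h3 ⟨k, ⟨Nat.pos_of_mul_pos_left h0, fun x hx hd => ?_⟩, rfl⟩
    have hx0 : 0 < x := by
      rcases Nat.eq_zero_or_pos x with rfl | h
      · rw [Nat.zero_div, zero_dvd_iff] at hd
        subst hd
        simp at h0
      · exact h
    exact h2 x hx ((dvd_mul_left_iff_div_gcd_dvd hx0).2 hd)

lemma multiples_avoidList_subset {e : ℕ} (he : 0 < e) (L : List ℕ) :
    {n | ∃ k ∈ avoidList (L.map fun x => x / x.gcd e), n = e * k} ⊆ avoidList L := by
  rintro n ⟨k, ⟨h0, hk⟩, rfl⟩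
  refine ⟨Nat.mul_pos he h0, fun x hx hd => ?_⟩
  rcases Nat.eq_zero_or_pos x with rfl | hx0
  · have := Nat.mul_pos he h0
    rw [zero_dvd_iff] at hd
    omega
  · exact hk _ (List.mem_map_of_mem hx) ((dvd_mul_left_iff_div_gcd_dvd hx0).1 hd)

lemma avoidList_zero_cons (L : List ℕ) : avoidList (0 :: L) = avoidList L := by
  ext n
  simp only [avoidList, Set.mem_ofPred_eq, List.forall_mem_cons, zero_dvd_iff]
  refine and_congr_right fun h => ?_
  simp [h.ne']

lemma exists_hasDensity_avoidList (L : List ℕ) : ∃ δ, HasDensity (avoidList L) δ := by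
  induction h : L.length generalizing L with
  | zero =>
    rw [List.length_eq_zero_iff] at h
    exact ⟨1, h ▸ hasDensity_avoidList_nil⟩
  | succ n ih =>
    obtain ⟨e, L, rfl⟩ := List.exists_cons_of_length_eq_add_one h
    rw [List.length_cons, Nat.add_right_cancel_iff] at h
    obtain ⟨a, ha⟩ := ih L h
    rcases Nat.eq_zero_or_pos e with rfl | he
    · exact ⟨a, by rwa [avoidList_zero_cons]⟩
    obtain ⟨b, hb⟩ := ih (L.map fun x => x / x.gcd e) (by rw [List.length_map, h])
    exact ⟨_, avoidList_cons e L ▸ ha.diff (hb.multiples he) (multiples_avoidList_subset he L)⟩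

lemma HasDensity.avoidList_cons_of_coprime {L : List ℕ} {a : ℝ} (ha : HasDensity (avoidList L) a)
    {e : ℕ} (he : 0 < e) (hc : ∀ x ∈ L, x.Coprime e) :
    HasDensity (avoidList (e :: L)) (a * (1 - 1 / e)) := by
  have hmap : (L.map fun x => x / x.gcd e) = L := by
    conv_rhs => rw [← List.map_id L]
    refine List.map_congr_left fun x hx => ?_
    rw [Nat.Coprime.gcd_eq_one (hc x hx), Nat.div_one, id]
  have ha' : HasDensity (avoidList (L.map fun x => x / x.gcd e)) a := by rwa [hmap]
  have h1 := ha.diff (ha'.multiples he) (multiples_avoidList_subset he L)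
  rw [← avoidList_cons e L] at h1
  convert h1 using 1
  ring

lemma hasDensity_avoidList_two : HasDensity (avoidList [2]) (1 / 2) := by
  have := hasDensity_avoidList_nil.avoidList_cons_of_coprime (e := 2) (by norm_num) (by simp)
  norm_num at this ⊢
  exact this

/-- Union bound for the odd numbers that avoid the members of `L`. -/
lemma half_sub_sum_le_density (L : List ℕ) {δ : ℝ} (h : HasDensity (avoidList (2 :: L)) δ) :
    1 / 2 - (L.map fun e : ℕ => if Odd e then 1 / (2 * e : ℝ) else 0).sum ≤ δ := by
  induction L generalizing δ with
  | nil => simpa using hasDensity_avoidList_two.mono h subset_rfl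
  | cons e L ih =>
    obtain ⟨a, ha⟩ := exists_hasDensity_avoidList (2 :: L)
    have h1 := ih ha
    rw [List.map_cons, List.sum_cons]
    split_ifs with he
    · have h2 := ha.le_add h (hasDensity_avoidList_two.multiples he.pos) ?_
      · have h3 : (1 : ℝ) / (2 * e) = 1 / 2 / e := by rw [div_div]
        rw [h3]
        linarith
      · rintro n ⟨h0, hn⟩
        simp only [List.forall_mem_cons] at hn
        by_cases hd : e ∣ n
        · obtain ⟨k, rfl⟩ := hd
          refine Or.inr ⟨k, ⟨Nat.pos_of_mul_pos_left h0, ?_⟩, rfl⟩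
          simpa using fun hk : 2 ∣ k => hn.1 (hk.mul_left e)
        · exact Or.inl ⟨h0, by simpa [-Nat.two_dvd_ne_zero] using ⟨hn.1, hd, hn.2⟩⟩
    · have h2 : avoidList (2 :: L) ⊆ avoidList (2 :: e :: L) := by
        rintro n ⟨h0, hn⟩
        simp only [List.forall_mem_cons] at hn
        have h2e : 2 ∣ e := even_iff_two_dvd.1 (Nat.not_odd_iff_even.1 he)
        exact ⟨h0, by simpa [-Nat.two_dvd_ne_zero] using ⟨hn.1, fun hd => hn.1 (h2e.trans hd), hn.2⟩⟩
      have := ha.mono h h2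
      linarith

lemma ncard_multiples_le (e N : ℕ) :
    ({n ∈ Set.Icc 1 N | e ∣ n}.ncard : ℝ) ≤ N * (1 / e) := by
  rcases Nat.eq_zero_or_pos e with rfl | he
  · have : {n ∈ Set.Icc 1 N | 0 ∣ n} = ∅ := by
      ext n
      simp
      omega
    rw [this]
    simp
  · have h1 : {n ∈ Set.Icc 1 N | e ∣ n} = {n | ∃ k ∈ Set.univ, n = e * k} ∩ Set.Icc 1 N := by
      ext n
      simp only [Set.mem_ofPred_eq, Set.mem_inter_iff, Set.mem_univ, true_and]
      exact and_comm
    rw [h1, ncard_multiples_inter_Icc Set.univ he, Set.univ_inter, ← Finset.coe_Icc,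
      Set.ncard_coe_finset, Nat.card_Icc, Nat.add_sub_cancel, mul_one_div]
    exact Nat.cast_div_le

lemma ncard_avoidList_le {e : ℕ → ℕ} (hs : Summable fun i => 1 / (e i : ℝ)) (P N : ℕ) :
    ((avoidList ((List.range P).map e) ∩ Set.Icc 1 N).ncard : ℝ) ≤
      (avoid e ∩ Set.Icc 1 N).ncard + N * ∑' i, 1 / (e (i + P) : ℝ) := by
  classical
  obtain ⟨X, hX⟩ : ∃ X : ℕ, ∀ i ≥ X, 1 / (e (i + P) : ℝ) < 1 / (N + 1 : ℝ) :=
    Filter.eventually_atTop.1 (((summable_nat_add_iff P).2 hs).tendsto_atTop_zero.eventually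
      (gt_mem_nhds (by positivity)))
  have hsub : avoidList ((List.range P).map e) ∩ Set.Icc 1 N ⊆
      (avoid e ∩ Set.Icc 1 N) ∪ ⋃ i ∈ Finset.range X, {n ∈ Set.Icc 1 N | e (i + P) ∣ n} := by
    rintro n ⟨⟨h0, hn⟩, hI⟩
    by_cases hav : n ∈ avoid e
    · exact Or.inl ⟨hav, hI⟩
    · right
      have : ∃ i, e i ∣ n := by
        by_contra! hh
        exact hav ⟨h0, hh⟩
      obtain ⟨i, hi⟩ := this
      have hPi : P ≤ i := by
        by_contra! hlt
        exact hn (e i) (List.mem_map_of_mem (List.mem_range.2 hlt)) hi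
      obtain ⟨j, rfl⟩ := Nat.exists_eq_add_of_le' hPi
      have hjX : j < X := by
        by_contra! hle
        have h1 := hX j hle
        have h2 : e (j + P) ≤ N := (Nat.le_of_dvd h0 hi).trans hI.2
        have h3 : 0 < e (j + P) := Nat.pos_of_dvd_of_pos hi h0
        have h4 : 1 / (N + 1 : ℝ) ≤ 1 / (e (j + P) : ℝ) :=
          one_div_le_one_div_of_le (by exact_mod_cast h3) (by exact_mod_cast (by omega))
        linarith
      simp only [Set.mem_iUnion]
      exact ⟨j, Finset.mem_range.2 hjX, hI, hi⟩
  have hfin : (⋃ i ∈ Finset.range X, {n ∈ Set.Icc 1 N | e (i + P) ∣ n}).Finite :=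
    (Set.finite_Icc 1 N).subset (Set.iUnion₂_subset fun i _ => Set.sep_subset _ _)
  have h1 := (Set.ncard_le_ncard hsub ((finite_inter_Icc _ N).union hfin)).trans
    (Set.ncard_union_le _ _)
  have h2 : ((⋃ i ∈ Finset.range X, {n ∈ Set.Icc 1 N | e (i + P) ∣ n}).ncard : ℝ) ≤
      ∑ i ∈ Finset.range X, N * (1 / (e (i + P) : ℝ)) := by
    have h3 := Finset.set_ncard_biUnion_le (Finset.range X)
      (fun i => {n ∈ Set.Icc 1 N | e (i + P) ∣ n})
    refine (Nat.cast_le.2 h3).trans ?_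
    push_cast
    exact Finset.sum_le_sum fun i _ => ncard_multiples_le _ N
  rw [← Finset.mul_sum] at h2
  have h4 : ∑ i ∈ Finset.range X, 1 / (e (i + P) : ℝ) ≤ ∑' i, 1 / (e (i + P) : ℝ) :=
    ((summable_nat_add_iff P).2 hs).sum_le_tsum _ fun i _ => by positivity
  have h5 := mul_le_mul_of_nonneg_left h4 (Nat.cast_nonneg (α := ℝ) N)
  have h6 : ((avoidList ((List.range P).map e) ∩ Set.Icc 1 N).ncard : ℝ) ≤
    (avoid e ∩ Set.Icc 1 N).ncard +
      (⋃ i ∈ Finset.range X, {n ∈ Set.Icc 1 N | e (i + P) ∣ n}).ncard := by exact_mod_cast h1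
  linarith

lemma exists_hasDensity_avoid {e : ℕ → ℕ} (hs : Summable fun i => 1 / (e i : ℝ)) {d : ℕ → ℝ}
    (hd : ∀ P, HasDensity (avoidList ((List.range P).map e)) (d P)) :
    ∃ δ, HasDensity (avoid e) δ ∧ Filter.Tendsto d Filter.atTop (nhds δ) := by
  have hanti : Antitone d := fun P P' h => (hd P').mono (hd P) fun n hn => ⟨hn.1, fun x hx => by
    obtain ⟨i, hi, rfl⟩ := List.mem_map.1 hx
    exact hn.2 _ (List.mem_map_of_mem (List.mem_range.2 ((List.mem_range.1 hi).trans_le h)))⟩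
  have hlim := tendsto_atTop_ciInf hanti
    ⟨0, by rintro _ ⟨P, rfl⟩; exact (hd P).nonneg⟩
  refine ⟨_, ?_, hlim⟩
  refine TendstoUniformly.tendsto_of_eventually_tendsto (p := Filter.atTop)
    (F := fun P N => ((avoidList ((List.range P).map e) ∩ Set.Icc 1 N).ncard : ℝ) / N) (L := d)
    ?_ (Filter.Eventually.of_forall hd) hlim
  rw [Metric.tendstoUniformly_iff]
  intro ε hε
  have htail := tendsto_sum_nat_add fun i => 1 / (e i : ℝ)
  filter_upwards [htail.eventually (gt_mem_nhds hε)] with P hP N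
  have h1 := ncard_avoidList_le hs P N
  have h2 : avoid e ∩ Set.Icc 1 N ⊆ avoidList ((List.range P).map e) ∩ Set.Icc 1 N := by
    rintro n ⟨hn, hI⟩
    refine ⟨⟨hn.1, fun x hx => ?_⟩, hI⟩
    obtain ⟨i, -, rfl⟩ := List.mem_map.1 hx
    exact hn.2 i
  have h3 : ((avoid e ∩ Set.Icc 1 N).ncard : ℝ) ≤
      (avoidList ((List.range P).map e) ∩ Set.Icc 1 N).ncard := by
    exact_mod_cast Set.ncard_le_ncard h2 (finite_inter_Icc _ N)
  rw [dist_comm, Real.dist_eq, ← sub_div, abs_of_nonneg (by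
    apply div_nonneg <;> [linarith; positivity])]
  rcases Nat.eq_zero_or_pos N with rfl | hN
  · simpa using hε
  · have hN' : (0 : ℝ) < N := by exact_mod_cast hN
    rw [div_lt_iff₀ hN']
    have := mul_lt_mul_of_pos_right hP hN'
    linarith

lemma hasDensity_avoidList_of_pairwise_coprime {L : List ℕ} (hpos : ∀ e ∈ L, 0 < e)
    (hc : L.Pairwise Nat.Coprime) :
    HasDensity (avoidList L) (L.map fun e : ℕ => (1 - 1 / e : ℝ)).prod := by
  induction L with
  | nil => simpa using hasDensity_avoidList_nil
  | cons e L ih =>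
    rw [List.forall_mem_cons] at hpos
    rw [List.pairwise_cons] at hc
    rw [List.map_cons, List.prod_cons, mul_comm]
    exact (ih hpos.2 hc.2).avoidList_cons_of_coprime hpos.1 fun x hx => (hc.1 x hx).symm

/-- The products of sublists of `L`. -/
def sublistProds : List ℕ → Finset ℕ
  | [] => {1}
  | q :: L => sublistProds L ∪ (sublistProds L).image (q * ·)

lemma mem_sublistProds {L : List ℕ} (hL : ∀ q ∈ L, q.Prime) {d : ℕ} (hd : d ∣ L.prod) :
    d ∈ sublistProds L := by
  induction L generalizing d with
  | nil => simpa [sublistProds] using hd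
  | cons q L ih =>
    rw [List.forall_mem_cons] at hL
    rw [List.prod_cons] at hd
    rw [sublistProds, Finset.mem_union, Finset.mem_image]
    by_cases hq : q ∣ d
    · obtain ⟨c, rfl⟩ := hq
      exact Or.inr ⟨c, ih hL.2 (Nat.dvd_of_mul_dvd_mul_left hL.1.pos hd), rfl⟩
    · exact Or.inl (ih hL.2 (((hL.1.coprime_iff_not_dvd.2 hq).symm).dvd_of_dvd_mul_left hd))

lemma sum_multiples_div_sq_le {g M : ℕ} (hg : 0 < g) (hM : 0 < M) (X : ℕ) :
    ∑ m ∈ Finset.Ico M X, (if g ∣ m then (g : ℝ) / m ^ 2 else 0) ≤ 2 / (max M g : ℕ) := by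
  obtain ⟨k, hk1, hk2⟩ : ∃ k, max M g ≤ g * (k + 1) ∧ g * k < M := by
    refine ⟨(M - 1) / g, ?_, ?_⟩
    · have := Nat.lt_mul_div_succ (M - 1) hg
      refine max_le (by omega) (Nat.le_mul_of_pos_right _ (Nat.succ_pos _))
    · have := Nat.mul_div_le (M - 1) g
      omega
  have hsub : (Finset.Ico M X).filter (g ∣ ·) ⊆ (Finset.Ioo k X).image (g * ·) := by
    intro m hm
    rw [Finset.mem_filter, Finset.mem_Ico] at hm
    obtain ⟨⟨h1, h2⟩, j, rfl⟩ := hm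
    refine Finset.mem_image.2 ⟨j, Finset.mem_Ioo.2 ⟨?_, ?_⟩, rfl⟩
    · exact Nat.lt_of_mul_lt_mul_left (hk2.trans_le h1)
    · exact (Nat.le_mul_of_pos_left j hg).trans_lt h2
  have hg' : (0 : ℝ) < g := by exact_mod_cast hg
  rw [← Finset.sum_filter]
  calc _ ≤ ∑ m ∈ (Finset.Ioo k X).image (g * ·), (g : ℝ) / (m : ℝ) ^ 2 :=
        Finset.sum_le_sum_of_subset_of_nonneg hsub fun _ _ _ => by positivity
    _ = ∑ j ∈ Finset.Ioo k X, (1 / g : ℝ) * ((j : ℝ) ^ 2)⁻¹ := by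
        rw [Finset.sum_image fun a _ b _ h => Nat.eq_of_mul_eq_mul_left hg h]
        refine Finset.sum_congr rfl fun j hj => ?_
        have : (j : ℝ) ≠ 0 := by
          have := (Finset.mem_Ioo.1 hj).1
          exact_mod_cast (by omega)
        push_cast
        field_simp
    _ ≤ (1 / g : ℝ) * (2 / (k + 1)) := by
        rw [← Finset.mul_sum]
        exact mul_le_mul_of_nonneg_left (sum_Ioo_inv_sq_le k X) (by positivity)
    _ = 2 / ((g * (k + 1) : ℕ) : ℝ) := by
        push_cast
        field_simp
    _ ≤ _ := by
        gcongr

/-- An upper bound for twice the density of the odd numbers removed by the prime `p`. -/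
noncomputable def removalBound (p : ℕ) : ℝ :=
  if p.Prime ∧ p % 4 = 3 ∧ ¬ p ∣ 47058 then
    ((p - 1).gcd 11072512110 : ℝ) / (p * (p - 1 : ℕ))
  else 0

lemma removalBound_nonneg (p : ℕ) : 0 ≤ removalBound p := by
  rw [removalBound]
  split_ifs <;> positivity

lemma div_le_div_add_one_div (a b c : ℕ) (hc : 0 < c) :
    (a : ℝ) / b ≤ ((c * a / b + 1 : ℕ) : ℝ) / c := by
  have hc' : (0 : ℝ) < c := by exact_mod_cast hc
  rw [le_div_iff₀ hc', Nat.cast_add_one, ← Nat.floor_div_eq_div (K := ℝ)]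
  refine le_trans (le_of_eq ?_) (Nat.lt_floor_add_one _).le
  push_cast
  ring

lemma sum_removalBound_head : ∑ p ∈ Finset.range 200, removalBound p ≤ 0.216342 := by
  have hle : ∀ p ∈ Finset.range 200, removalBound p ≤
      ((if p % 4 = 3 ∧ ¬ p ∣ 47058 ∧ ∀ q ∈ [3, 5, 7, 11, 13], q ∣ p → q = p then
        10 ^ 6 * (p - 1).gcd 11072512110 / (p * (p - 1)) + 1 else 0 : ℕ) : ℝ) / (10 ^ 6 : ℕ) := by
    intro p _
    rw [removalBound]
    split_ifs with h1 h2
    · rw [← Nat.cast_mul]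
      exact div_le_div_add_one_div _ _ _ (by norm_num)
    · refine absurd ⟨h1.2.1, h1.2.2, fun q hq hqp => ?_⟩ h2
      refine (h1.1.eq_one_or_self_of_dvd q hqp).resolve_left ?_
      rintro rfl
      simp at hq
    · positivity
    · simp
  refine (Finset.sum_le_sum hle).trans ?_
  rw [← Finset.sum_div, ← Nat.cast_sum]
  have : (∑ p ∈ Finset.range 200,
      (if p % 4 = 3 ∧ ¬ p ∣ 47058 ∧ ∀ q ∈ [3, 5, 7, 11, 13], q ∣ p → q = p then
        10 ^ 6 * (p - 1).gcd 11072512110 / (p * (p - 1)) + 1 else 0)) ≤ 216342 := by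
    decide +kernel
  have h := Nat.cast_le (α := ℝ).2 this
  rw [div_le_iff₀ (by norm_num)]
  refine h.trans ?_
  norm_num

lemma removalBound_le_sum {p : ℕ} (hp : 200 ≤ p) :
    removalBound p ≤ ∑ h ∈ sublistProds [3, 5, 11, 23, 31, 47059],
      if 2 * h ∣ p - 1 then ((2 * h : ℕ) : ℝ) / (p - 1 : ℕ) ^ 2 else 0 := by
  have hnn : ∀ h ∈ sublistProds [3, 5, 11, 23, 31, 47059],
      0 ≤ if 2 * h ∣ p - 1 then ((2 * h : ℕ) : ℝ) / (p - 1 : ℕ) ^ 2 else (0 : ℝ) := by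
    intro h _
    split_ifs <;> positivity
  rw [removalBound]
  split_ifs with hc
  · obtain ⟨h, hh⟩ : 2 ∣ (p - 1).gcd 11072512110 := Nat.dvd_gcd (by omega) (by norm_num)
    have hmem : h ∈ sublistProds [3, 5, 11, 23, 31, 47059] := by
      refine mem_sublistProds (by norm_num) ?_
      have : 2 * h ∣ 2 * 5536256055 := hh ▸ Nat.gcd_dvd_right (p - 1) 11072512110
      have := Nat.dvd_of_mul_dvd_mul_left two_pos this
      norm_num [this]
    refine le_trans ?_ (Finset.single_le_sum hnn hmem)
    rw [if_pos (hh ▸ Nat.gcd_dvd_left _ _), hh, sq]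
    have : (0 : ℝ) < (p - 1 : ℕ) := by exact_mod_cast (by omega)
    gcongr
    omega
  · exact Finset.sum_nonneg hnn

lemma sum_removalBound_tail (X : ℕ) : ∑ p ∈ Finset.Ico 200 X, removalBound p ≤ 0.150358 := by
  calc _ ≤ ∑ p ∈ Finset.Ico 200 X, ∑ h ∈ sublistProds [3, 5, 11, 23, 31, 47059],
        (if 2 * h ∣ p - 1 then ((2 * h : ℕ) : ℝ) / (p - 1 : ℕ) ^ 2 else 0) :=
        Finset.sum_le_sum fun p hp => removalBound_le_sum (Finset.mem_Ico.1 hp).1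
    _ = ∑ h ∈ sublistProds [3, 5, 11, 23, 31, 47059], ∑ p ∈ Finset.Ico 200 X,
        (if 2 * h ∣ p - 1 then ((2 * h : ℕ) : ℝ) / (p - 1 : ℕ) ^ 2 else 0) := Finset.sum_comm
    _ ≤ ∑ h ∈ sublistProds [3, 5, 11, 23, 31, 47059],
        ((10 ^ 6 * 2 / max 199 (2 * h) + 1 : ℕ) : ℝ) / (10 ^ 6 : ℕ) := by
        refine Finset.sum_le_sum fun h hh => ?_
        have hpos : ∀ h ∈ sublistProds [3, 5, 11, 23, 31, 47059], 0 < h := by decide +kernel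
        have h1 := sum_multiples_div_sq_le (g := 2 * h) (M := 199)
          (Nat.mul_pos two_pos (hpos h hh)) (by norm_num) (X - 1)
        have h2 : ∑ p ∈ Finset.Ico 200 X,
            (if 2 * h ∣ p - 1 then ((2 * h : ℕ) : ℝ) / (p - 1 : ℕ) ^ 2 else 0) =
            ∑ m ∈ Finset.Ico 199 (X - 1),
              (if 2 * h ∣ m then ((2 * h : ℕ) : ℝ) / (m : ℝ) ^ 2 else 0) := by
          rcases le_or_gt X 200 with hX | hX
          · rw [Finset.Ico_eq_empty (by omega), Finset.Ico_eq_empty (by omega)]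
            simp
          · obtain ⟨Y, rfl⟩ : ∃ Y, X = Y + 1 := ⟨X - 1, by omega⟩
            exact (Finset.sum_Ico_add' (fun p : ℕ =>
              (if 2 * h ∣ p - 1 then ((2 * h : ℕ) : ℝ) / ((p - 1 : ℕ) : ℝ) ^ 2 else 0))
              199 Y 1).symm
        rw [h2]
        exact h1.trans (div_le_div_add_one_div 2 _ _ (by norm_num))
    _ ≤ _ := by
        rw [← Finset.sum_div, ← Nat.cast_sum]
        have : (∑ h ∈ sublistProds [3, 5, 11, 23, 31, 47059],
            (10 ^ 6 * 2 / max 199 (2 * h) + 1)) ≤ 150358 := by decide +kernel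
        have h := Nat.cast_le (α := ℝ).2 this
        rw [div_le_iff₀ (by norm_num)]
        refine h.trans ?_
        norm_num

lemma sum_removalBound_le (X : ℕ) : ∑ p ∈ Finset.range X, removalBound p ≤ 0.3667 := by
  calc _ ≤ ∑ p ∈ Finset.range (max 200 X), removalBound p :=
        Finset.sum_le_sum_of_subset_of_nonneg
          (Finset.range_subset_range.2 (le_max_right _ _)) fun p _ _ => removalBound_nonneg p
    _ = ∑ p ∈ Finset.range 200, removalBound p + ∑ p ∈ Finset.Ico 200 (max 200 X), removalBound p :=
        (Finset.sum_range_add_sum_Ico _ (le_max_left _ _)).symm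
    _ ≤ 0.216342 + 0.150358 := add_le_add sum_removalBound_head (sum_removalBound_tail _)
    _ = 0.3667 := by norm_num

lemma one_div_obstruction {Q p : ℕ} (hp : p.Prime) (hpQ : ¬ p ∣ Q) (hp5 : p ≠ 5) :
    1 / (obstruction Q p : ℝ) = ((p - 1).gcd (5 * Q) : ℝ) / (p * (p - 1 : ℕ)) := by
  have hp2 := hp.two_le
  have hg : 0 < (p - 1).gcd (5 * Q) := Nat.gcd_pos_of_pos_left _ (by omega)
  have hg' : (((p - 1).gcd (5 * Q) : ℕ) : ℝ) ≠ 0 := by exact_mod_cast hg.ne'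
  rw [obstruction, if_pos ⟨hp, hpQ⟩, if_neg hp5, Nat.cast_mul,
    Nat.cast_div (Nat.gcd_dvd_left _ _) hg']
  rw [mul_div_assoc', one_div_div]

lemma summable_one_div_obstruction {Q : ℕ} (hQ : 2 ≤ Q) :
    Summable fun p => 1 / (obstruction Q p : ℝ) := by
  refine Summable.of_nonneg_of_le (fun p => by positivity) (fun p => ?_)
    ((Real.summable_one_div_nat_pow.2 one_lt_two).mul_left (10 * Q : ℝ))
  have hQ' : (2 : ℝ) ≤ Q := by exact_mod_cast hQ
  by_cases hpc : p.Prime ∧ ¬ p ∣ Q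
  · obtain ⟨hp, hpQ⟩ := hpc
    by_cases hp5 : p = 5
    · subst hp5
      rw [obstruction, if_pos ⟨hp, hpQ⟩, if_pos rfl]
      norm_num
      linarith
    · rw [one_div_obstruction hp hpQ hp5]
      have hp2 : (2 : ℝ) ≤ p := by exact_mod_cast hp.two_le
      have hg : (((p - 1).gcd (5 * Q) : ℕ) : ℝ) ≤ 5 * Q := by
        exact_mod_cast Nat.gcd_le_right _ (by omega)
      rw [Nat.cast_sub hp.one_le, Nat.cast_one, mul_one_div,
        div_le_div_iff₀ (by nlinarith) (by positivity)]
      calc _ ≤ 5 * Q * (p : ℝ) ^ 2 := by gcongr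
        _ ≤ 5 * Q * (2 * (p * (p - 1))) := by
          gcongr
          nlinarith
        _ = _ := by ring
  · rw [obstruction, if_neg hpc]
    simp
    positivity

lemma ite_odd_obstruction_le {Q : ℕ} (h4 : Q % 4 = 2) (h1 : 47058 ∣ Q) (h2 : Q ∣ 2214502422)
    (p : ℕ) :
    (if Odd (obstruction Q p) then 1 / (2 * obstruction Q p : ℝ) else 0) ≤
      1 / 2 * removalBound p := by
  have hnn := removalBound_nonneg p
  split_ifs with hodd
  swap
  · linarith
  by_cases hpc : p.Prime ∧ ¬ p ∣ Q
  swap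
  · rw [obstruction, if_neg hpc] at hodd
    simp at hodd
  obtain ⟨hp, hpQ⟩ := hpc
  by_cases hp5 : p = 5
  · rw [obstruction, if_pos ⟨hp, hpQ⟩, if_pos hp5] at hodd
    exact absurd hodd (by decide)
  rw [← one_div_mul_one_div, one_div_obstruction hp hpQ hp5]
  rw [obstruction, if_pos ⟨hp, hpQ⟩, if_neg hp5, Nat.odd_mul] at hodd
  have hmod : p % 4 = 3 := by
    obtain ⟨ho, hc⟩ := hodd
    by_contra hne
    have h4p : 4 ∣ p - 1 := by
      rw [Nat.odd_iff] at ho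
      omega
    rw [← Nat.div_mul_cancel (Nat.gcd_dvd_left (p - 1) (5 * Q))] at h4p
    have hcop : Nat.Coprime 4 ((p - 1) / (p - 1).gcd (5 * Q)) :=
      Nat.Coprime.pow_left 2 (Nat.coprime_two_left.2 hc)
    have := (hcop.dvd_of_dvd_mul_left h4p).trans (Nat.gcd_dvd_right _ _)
    clear h1 h2
    omega
  rw [removalBound, if_pos ⟨hp, hmod, fun hd => hpQ (hd.trans h1)⟩]
  have hle : (p - 1).gcd (5 * Q) ≤ (p - 1).gcd 11072512110 :=
    Nat.le_of_dvd (Nat.gcd_pos_of_pos_right _ (by norm_num))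
      (Nat.gcd_dvd_gcd_of_dvd_right _ (Nat.mul_dvd_mul_left 5 h2))
  gcongr

lemma density_avoid_obstruction {Q : ℕ} (h4 : Q % 4 = 2) (h1 : 47058 ∣ Q) (h2 : Q ∣ 2214502422)
    (hL : ∀ l ∈ [2, 7, 47, 57, 67, 139, 311, 331, 683, 691], ∃ p, obstruction Q p ∣ l) :
    ∃ δ, HasDensity (avoid (obstruction Q)) δ ∧ 0.3166 < δ ∧ δ < 0.39936 := by
  choose d hd using fun P => exists_hasDensity_avoidList ((List.range P).map (obstruction Q))
  obtain ⟨δ, hδ, hlim⟩ := exists_hasDensity_avoid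
    (summable_one_div_obstruction (by clear h1 h2; omega)) hd
  refine ⟨δ, hδ, ?_, ?_⟩
  · have hlow : 0.31665 ≤ δ := by
      refine ge_of_tendsto hlim ?_
      filter_upwards [Filter.eventually_gt_atTop 5] with P hP
      have h5 : obstruction Q 5 = 2 := by
        have hn5 : ¬ 5 ∣ Q := fun h5 => absurd (h5.trans h2) (by norm_num)
        rw [obstruction, if_pos ⟨Nat.prime_five, hn5⟩, if_pos rfl]
      have heq : avoidList ((List.range P).map (obstruction Q)) =
          avoidList (2 :: (List.range P).map (obstruction Q)) := by
        ext n
        simp only [avoidList, Set.mem_ofPred_eq, List.forall_mem_cons]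
        refine and_congr_right fun _ => (and_iff_right_of_imp fun h => ?_).symm
        exact h 2 (List.mem_map.2 ⟨5, List.mem_range.2 hP, h5⟩)
      have h := half_sub_sum_le_density _ (heq ▸ hd P)
      have hsum : (((List.range P).map (obstruction Q)).map fun e : ℕ =>
          if Odd e then 1 / (2 * e : ℝ) else 0).sum ≤ 1 / 2 * 0.3667 := by
        rw [List.map_map]
        calc _ = ∑ p ∈ Finset.range P,
              (if Odd (obstruction Q p) then 1 / (2 * obstruction Q p : ℝ) else 0) := rfl
          _ ≤ ∑ p ∈ Finset.range P, 1 / 2 * removalBound p :=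
              Finset.sum_le_sum fun p _ => ite_odd_obstruction_le h4 h1 h2 p
          _ = 1 / 2 * ∑ p ∈ Finset.range P, removalBound p := (Finset.mul_sum _ _ _).symm
          _ ≤ _ := by
              gcongr
              exact sum_removalBound_le P
      norm_num at hsum h ⊢
      linarith
    norm_num at hlow ⊢
    linarith
  · have hup := hδ.mono (hasDensity_avoidList_of_pairwise_coprime
      (L := [2, 7, 47, 57, 67, 139, 311, 331, 683, 691]) (by norm_num) (by norm_num))
      fun k hk => ⟨hk.1, fun l hl hd => by
        obtain ⟨p, hp⟩ := hL l hl
        exact hk.2 p (hp.trans hd)⟩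
    refine hup.trans_lt ?_
    norm_num

lemma density_Nset {Q : ℕ} (hQ : ∀ p q : ℕ, p.Prime → Q = p * q → p ∣ q + 1)
    (hpred : ∀ p : ℕ, p.Prime → p ∣ Q → p - 1 ∣ 5 * Q)
    (h4 : Q % 4 = 2) (h1 : 47058 ∣ Q) (h2 : Q ∣ 2214502422)
    (hL : ∀ l ∈ [2, 7, 47, 57, 67, 139, 311, 331, 683, 691], ∃ p, obstruction Q p ∣ l) :
    ∃ δ, HasDensity (Nset Q) δ ∧ 0.0633 < δ ∧ δ < 0.0799 := by
  obtain ⟨δ, hδ, hl, hu⟩ := density_avoid_obstruction h4 h1 h2 hL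
  refine ⟨δ / (5 : ℕ), ?_, ?_, ?_⟩
  · rw [Nset_eq_image_avoid (by clear h1 h2; omega) hQ ((by norm_num : 31 ∣ 47058).trans h1)
      (fun h5 => absurd (h5.trans h2) (by norm_num)) h4 hpred]
    exact hδ.multiples (by norm_num)
  · norm_num at hl ⊢
    linarith
  · norm_num at hu ⊢
    linarith

lemma prime_dvd_47058 {p : ℕ} (hp : p.Prime) (h : p ∣ 47058) : p ∈ [2, 3, 11, 23, 31] := by
  rw [show 47058 = [2, 3, 11, 23, 31].prod by norm_num] at h
  exact mem_list_primes_of_dvd_prod hp.prime (by norm_num [Nat.prime_iff.symm]) h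

lemma prime_dvd_2214502422 {p : ℕ} (hp : p.Prime) (h : p ∣ 2214502422) :
    p ∈ [2, 3, 11, 23, 31, 47059] := by
  rw [show 2214502422 = [2, 3, 11, 23, 31, 47059].prod by norm_num] at h
  exact mem_list_primes_of_dvd_prod hp.prime (by norm_num [Nat.prime_iff.symm]) h

theorem density_bounds_47058_2214502422 :
    (∃ δ : ℝ, HasDensity (Nset 47058) δ ∧ 0.0560465 < δ ∧ δ < 0.0800567) ∧
    (∃ δ : ℝ, HasDensity (Nset 2214502422) δ ∧ 0.0070565 < δ ∧ δ < 0.0800567) := by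
  constructor
  · obtain ⟨δ, hδ, hl, hu⟩ := density_Nset (Q := 47058)
      (fun p q hp h => by
        have := prime_dvd_47058 hp ⟨q, h⟩
        simp only [List.mem_cons, List.not_mem_nil, or_false] at this
        rcases this with rfl | rfl | rfl | rfl | rfl <;> omega)
      (fun p hp h => by
        have := prime_dvd_47058 hp h
        simp only [List.mem_cons, List.not_mem_nil, or_false] at this
        rcases this with rfl | rfl | rfl | rfl | rfl <;> norm_num)
      (by norm_num) (by norm_num) (by norm_num)
      (by
        simp only [List.forall_mem_cons]
        exact ⟨⟨5, by norm_num [obstruction]⟩, ⟨7, by norm_num [obstruction]⟩,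
          ⟨47, by norm_num [obstruction]⟩, ⟨19, by norm_num [obstruction]⟩,
          ⟨67, by norm_num [obstruction]⟩, ⟨139, by norm_num [obstruction]⟩,
          ⟨311, by norm_num [obstruction]⟩, ⟨331, by norm_num [obstruction]⟩,
          ⟨683, by norm_num [obstruction]⟩, ⟨691, by norm_num [obstruction]⟩, by simp⟩)
    exact ⟨δ, hδ, by norm_num at hl ⊢; linarith, by norm_num at hu ⊢; linarith⟩
  · obtain ⟨δ, hδ, hl, hu⟩ := density_Nset (Q := 2214502422)
      (fun p q hp h => by
        have := prime_dvd_2214502422 hp ⟨q, h⟩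
        simp only [List.mem_cons, List.not_mem_nil, or_false] at this
        rcases this with rfl | rfl | rfl | rfl | rfl | rfl <;> omega)
      (fun p hp h => by
        have := prime_dvd_2214502422 hp h
        simp only [List.mem_cons, List.not_mem_nil, or_false] at this
        rcases this with rfl | rfl | rfl | rfl | rfl | rfl <;> norm_num)
      (by norm_num) (by norm_num) (by norm_num)
      (by
        simp only [List.forall_mem_cons]
        exact ⟨⟨5, by norm_num [obstruction]⟩, ⟨7, by norm_num [obstruction]⟩,
          ⟨47, by norm_num [obstruction]⟩, ⟨19, by norm_num [obstruction]⟩,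
          ⟨67, by norm_num [obstruction]⟩, ⟨139, by norm_num [obstruction]⟩,
          ⟨311, by norm_num [obstruction]⟩, ⟨331, by norm_num [obstruction]⟩,
          ⟨683, by norm_num [obstruction]⟩, ⟨691, by norm_num [obstruction]⟩, by simp⟩)
    exact ⟨δ, hδ, by norm_num at hl ⊢; linarith, by norm_num at hu ⊢; linarith⟩
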